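/- For every choice of pairwise distinct indices i, j, k ∈ {1,…,10}, the determinantal arrangement in P^14 defined by F_{ijk} = f_i·f_j·f_k is not free; that is, the module of Jacobian syzygies AR(F_{ijk}) is not a free S-module. -/

import Mathlib

open MvPolynomial

noncomputable section

/-- The polynomial ring `S = ℂ[x_{i,j} : 1 ≤ i ≤ 3, 1 ≤ j ≤ 5]`,
the entries of the generic `3 × 5` matrix. -/
abbrev S : Type := MvPolynomial (Fin 3 × Fin 5) ℂ

/-- The linear map `(a_v)_v ↦ ∑ v, a_v · ∂F/∂x_v`. -/
def jacMap {R : Type} [CommRing R] {σ : Type} [Fintype σ] [DecidableEq σ]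
    (F : MvPolynomial σ R) : (σ → MvPolynomial σ R) →ₗ[MvPolynomial σ R] MvPolynomial σ R where
  toFun a := ∑ v, a v * pderiv v F
  map_add' a b := by simp [add_mul, Finset.sum_add_distrib]
  map_smul' c a := by simp [Finset.mul_sum, smul_eq_mul, mul_assoc]

/-- The module of Jacobian syzygies `AR(F)`. -/
def AR {R : Type} [CommRing R] {σ : Type} [Fintype σ] [DecidableEq σ]
    (F : MvPolynomial σ R) : Submodule (MvPolynomial σ R) (σ → MvPolynomial σ R) :=
  LinearMap.ker (jacMap F)

/-- The `3`-minor `Δ_{abc}` of the generic `3 × 5` matrix on columns `a, b, c`. -/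
def Δ (a b c : Fin 5) : S :=
  Matrix.det (Matrix.of fun i k : Fin 3 => X (i, ![a, b, c] k))

/-- The ten minors `f₁, …, f₁₀` (zero-indexed: `f 0 = f₁`, …, `f 9 = f₁₀`). -/
def f : Fin 10 → S :=
  ![Δ 0 1 2, Δ 0 1 3, Δ 0 2 3, Δ 1 2 3, Δ 0 1 4,
    Δ 0 2 4, Δ 1 2 4, Δ 0 3 4, Δ 1 3 4, Δ 2 3 4]

/-- In a unique factorization domain, if `a` divides `g w * b` for all `w` and the `g w` have no
common prime factor, then `a` divides `b`. -/
theorem dvd_of_forall_dvd_mul {R ι : Type*} [CommRing R] [IsDomain R]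
    [UniqueFactorizationMonoid R] {g : ι → R} (hg : ∀ p, Prime p → ∃ w, ¬ p ∣ g w) {a : R}
    (ha : a ≠ 0) (b : R) (h : ∀ w, a ∣ g w * b) : a ∣ b := by
  induction a using UniqueFactorizationMonoid.induction_on_prime generalizing b with
  | h₁ => exact absurd rfl ha
  | h₂ x hx => exact hx.dvd
  | h₃ a p ha0 hp ih =>
    obtain ⟨w, hw⟩ := hg p hp
    obtain ⟨b, rfl⟩ := (hp.dvd_or_dvd ((dvd_mul_right p a).trans (h w))).resolve_left hw
    refine mul_dvd_mul_left p (ih ha0 b fun v => ?_)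
    have := h v
    rw [mul_left_comm] at this
    exact (mul_dvd_mul_iff_left hp.ne_zero).1 this

/-- A determinant is divisible by `t ^ #s` when every row indexed by `s` is divisible by `t`. -/
theorem pow_card_dvd_det {R n : Type*} [CommRing R] [Fintype n] [DecidableEq n]
    (A : Matrix n n R) (s : Finset n) (t : R) (h : ∀ i ∈ s, ∀ j, t ∣ A i j) :
    t ^ s.card ∣ A.det := by
  rw [← Matrix.det_transpose, Matrix.det_apply']
  refine Finset.dvd_sum fun π _ => Dvd.dvd.mul_left ?_ _
  rw [← Finset.prod_const]
  exact (Finset.prod_dvd_prod_of_dvd _ _ fun i hi => h i hi _).trans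
    (Finset.prod_dvd_prod_of_subset _ _ _ (Finset.subset_univ s))

/-- Replacing the column `w` of the matrix of Koszul relations `g w • e v - g v • e w` by the unit
vector `e u` gives a matrix whose determinant divides a power of `g w` times `g u`. -/
theorem det_koszul_dvd {R n : Type*} [CommRing R] [Fintype n] [DecidableEq n] (g : n → R)
    (w u : n) :
    (Matrix.of fun r v : n => g w * (Pi.single v 1 : n → R) r - g v * (Pi.single w 1 : n → R) r
      + (Pi.single u 1 : n → R) r * (Pi.single w 1 : n → R) v).det ∣
      g w ^ (Fintype.card n - 1) * g u := by
  set M : Matrix n n R := Matrix.of fun r v : n => g w * (Pi.single v 1 : n → R) r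
    - g v * (Pi.single w 1 : n → R) r + (Pi.single u 1 : n → R) r * (Pi.single w 1 : n → R) v with hM
  set N := (1 : Matrix n n R).updateRow w g * M with hN
  have hNw : ∀ v, N w v = g u * (Pi.single w 1 : n → R) v := by
    intro v
    simp [hN, Matrix.mul_apply, hM, mul_add, mul_sub, Finset.sum_add_distrib, Pi.single_apply]
    ring
  have hNr : ∀ r, r ≠ w → ∀ v, N r v =
      g w * (Pi.single v 1 : n → R) r + (Pi.single u 1 : n → R) r * (Pi.single w 1 : n → R) v := by
    intro r hr v
    simp [hN, Matrix.mul_apply, hM, Matrix.one_apply, Pi.single_apply, hr]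
  have hdet : N.det = g w ^ (Fintype.card n - 1) * g u := by
    rw [Matrix.twoBlockTriangular_det N (fun r => r ≠ w)]
    · have h1 : N.toSquareBlockProp (fun r => r ≠ w) = g w • 1 := by
        ext ⟨r, hr⟩ ⟨v, hv⟩
        simp [Matrix.toSquareBlockProp, hNr r hr, Matrix.one_apply, Pi.single_apply, hv]
      have : Unique {r // ¬ r ≠ w} := ⟨⟨⟨w, by simp⟩⟩, fun x => by ext; simpa using x.2⟩
      rw [h1, Matrix.det_smul, Matrix.det_one, mul_one, Matrix.det_unique]
      have hd : ((default : {r // ¬ r ≠ w}) : n) = w := by simpa using (default : {r // ¬ r ≠ w}).2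
      have hc : Fintype.card {r // r ≠ w} = Fintype.card n - 1 := by
        simp [Fintype.card_subtype_compl]
      simp [Matrix.toSquareBlockProp, hd, hNw, hc]
    · intro r hr v hv
      obtain rfl : r = w := by simpa using hr
      simp [hNw, hv]
  exact ⟨_, by rw [← hdet, hN, Matrix.det_mul, mul_comm]⟩

/-- Pulling back a homogeneous polynomial to the line through the origin and `P`. -/
theorem aeval_line {σ K : Type*} [Field K] {q : MvPolynomial σ K} {n : ℕ}
    (hq : q.IsHomogeneous n) (P : σ → K) :
    aeval (fun v => Polynomial.C (P v) * Polynomial.X) q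
      = Polynomial.C (eval P q) * Polynomial.X ^ n := by
  rw [q.as_sum, map_sum, map_sum, map_sum, Finset.sum_mul]
  refine Finset.sum_congr rfl fun d hd => ?_
  have hdeg : d.sum (fun _ e => e) = n := by
    have := hq (mem_support_iff.1 hd)
    simpa [Finsupp.weight_apply] using this
  rw [aeval_monomial, eval_monomial, ← hdeg]
  simp only [mul_pow, map_mul, Polynomial.algebraMap_eq, mul_assoc,
    Finsupp.prod, Finsupp.sum, map_prod, map_pow, Finset.prod_mul_distrib,
    Finset.prod_pow_eq_pow_sum]

theorem eval_zero_aeval_line {σ K : Type*} [Field K] (q : MvPolynomial σ K) (P : σ → K) :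
    Polynomial.eval 0 (aeval (fun v => Polynomial.C (P v) * Polynomial.X) q)
      = constantCoeff q := by
  induction q using MvPolynomial.induction_on with
  | C c => simp
  | add p q hp hq => simp [hp, hq]
  | mul_X p v hp => simp

/-- A Jacobian syzygy of a homogeneous polynomial has as its constant term a constant syzygy. -/
theorem constantCoeff_mem_AR {σ K : Type} [Field K] [Infinite K] [Fintype σ] [DecidableEq σ]
    {F : MvPolynomial σ K} {n : ℕ} (hF : F.IsHomogeneous (n + 1)) {a : σ → MvPolynomial σ K}
    (ha : a ∈ AR F) : ∑ v, C (constantCoeff (a v)) * pderiv v F = 0 := by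
  apply MvPolynomial.funext
  intro P
  have ha' : ∑ v, a v * pderiv v F = 0 := ha
  have h := congrArg (aeval (fun v => Polynomial.C (P v) * Polynomial.X)) ha'
  simp only [map_sum, map_mul, map_zero, aeval_line hF.pderiv P, Nat.add_sub_cancel, ← mul_assoc,
    ← Finset.sum_mul] at h
  have h0 := congrArg (Polynomial.eval 0)
    ((mul_eq_zero.1 h).resolve_right (pow_ne_zero _ Polynomial.X_ne_zero))
  simpa [Polynomial.eval_finsetSum, eval_zero_aeval_line] using h0

/-- The module of Jacobian syzygies of a nonconstant polynomial has corank one. -/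
theorem finrank_AR {σ K : Type} [Field K] [Fintype σ] [DecidableEq σ]
    {F : MvPolynomial σ K} {u : σ} (hu : pderiv u F ≠ 0) :
    Module.finrank (MvPolynomial σ K) (AR F) + 1 = Fintype.card σ := by
  have h1 := LinearMap.rank_range_add_rank_ker (jacMap F)
  have h2 : Module.rank (MvPolynomial σ K) (LinearMap.range (jacMap F)) = 1 := by
    apply le_antisymm
    · exact (Submodule.rank_le _).trans (by simp)
    · rw [Cardinal.one_le_iff_ne_zero, ← pos_iff_ne_zero, rank_pos_iff_exists_ne_zero]
      refine ⟨⟨jacMap F (Pi.single u 1), LinearMap.mem_range_self _ _⟩, ?_⟩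
      intro h
      apply hu
      simpa [jacMap, Pi.single_apply] using congrArg Subtype.val h
  rw [h2, rank_fun'] at h1
  have h3 := congrArg Cardinal.toNat h1
  have hfin : Module.rank (MvPolynomial σ K) (LinearMap.ker (jacMap F)) < Cardinal.aleph0 :=
    lt_of_le_of_lt (le_add_self.trans h1.le) (Cardinal.natCast_lt_aleph0)
  rw [Cardinal.toNat_add Cardinal.one_lt_aleph0 hfin] at h3
  rw [AR, Module.finrank]
  simp at h3
  omega

/-- A homogeneous polynomial of degree `n + 1` which depends essentially on more than `n + 1`
variables and whose partial derivatives have no common prime factor is not free. -/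
theorem not_free_AR {σ K : Type} [Field K] [Infinite K] [Fintype σ] [DecidableEq σ]
    {F : MvPolynomial σ K} {n : ℕ} (hF : F.IsHomogeneous (n + 1)) (s : Finset σ)
    (hs : n + 1 < s.card)
    (hconst : ∀ c : σ → K, ∑ v, C (c v) * pderiv v F = 0 → ∀ v ∈ s, c v = 0)
    (hprime : ∀ p, Prime p → ∃ w, ¬ p ∣ pderiv w F) :
    ¬ Module.Free (MvPolynomial σ K) (AR F) := by
  intro hfree
  obtain ⟨x, -⟩ : s.Nonempty := Finset.card_pos.1 (by omega)
  obtain ⟨u, hu⟩ : ∃ u, pderiv u F ≠ 0 :=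
    (hprime (X x) (X_prime)).imp fun w hw h => hw (h ▸ dvd_zero _)
  have hrank := finrank_AR hu
  let b := Module.Free.chooseBasis (MvPolynomial σ K) (AR F)
  set ι := Module.Free.ChooseBasisIndex (MvPolynomial σ K) (AR F)
  have hcard : Fintype.card σ = Fintype.card (Option ι) := by
    rw [Fintype.card_option, ← hrank, Module.finrank_eq_card_basis b]
  let e : σ ≃ Option ι := Fintype.equivOfCardEq hcard
  let B : Matrix σ (Option ι) (MvPolynomial σ K) :=
    Matrix.of fun r o =>
      o.elim ((Pi.single u 1 : σ → MvPolynomial σ K) r) fun i => (b i : σ → MvPolynomial σ K) r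
  have hB : ∀ w, (B.submatrix id e).det ∣ pderiv w F ^ (Fintype.card σ - 1) * pderiv u F := by
    intro w
    have hk : ∀ v, pderiv w F • (Pi.single v 1 : σ → MvPolynomial σ K)
        - pderiv v F • (Pi.single w 1 : σ → MvPolynomial σ K) ∈ AR F := by
      intro v
      change ∑ r, _ = _
      simp [sub_mul, Pi.single_apply]
      ring
    let Q : Matrix (Option ι) σ (MvPolynomial σ K) :=
      Matrix.of fun o v =>
        o.elim ((Pi.single w 1 : σ → MvPolynomial σ K) v) fun i => b.repr ⟨_, hk v⟩ i
    have hBQ : B * Q = Matrix.of fun r v : σ =>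
        pderiv w F * (Pi.single v 1 : σ → MvPolynomial σ K) r
        - pderiv v F * (Pi.single w 1 : σ → MvPolynomial σ K) r
        + (Pi.single u 1 : σ → MvPolynomial σ K) r * (Pi.single w 1 : σ → MvPolynomial σ K) v := by
      ext1 r v
      have h := congrArg (fun z : AR F => (z : σ → MvPolynomial σ K) r) (b.sum_repr ⟨_, hk v⟩)
      simp only [Submodule.coe_sum, Submodule.coe_smul, Finset.sum_apply, Pi.smul_apply,
        smul_eq_mul] at h
      simpa [Matrix.mul_apply, Fintype.sum_option, B, Q, mul_comm, add_comm] using h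
    refine Dvd.dvd.trans ?_ (det_koszul_dvd (fun v => pderiv v F) w u)
    rw [← hBQ]
    refine ⟨(Q.submatrix e id).det, ?_⟩
    rw [← Matrix.det_mul, Matrix.submatrix_mul_equiv, Matrix.submatrix_id_id]
  have hB0 : (B.submatrix id e).det ≠ 0 := fun h =>
    mul_ne_zero (pow_ne_zero _ hu) hu (zero_dvd_iff.1 (h ▸ hB u))
  have hBu : (B.submatrix id e).det ∣ pderiv u F := by
    refine dvd_of_forall_dvd_mul (fun p hp => ?_) hB0 _ hB
    exact (hprime p hp).imp fun w hw h => hw (hp.dvd_of_dvd_pow h)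
  obtain ⟨P, hP⟩ : ∃ P, eval P (pderiv u F) ≠ 0 := by
    by_contra! h
    exact hu (MvPolynomial.funext fun P => by simpa using h P)
  let φ : MvPolynomial σ K →ₐ[K] Polynomial K :=
    aeval (fun v => Polynomial.C (P v) * Polynomial.X)
  have hX : ∀ q : MvPolynomial σ K, constantCoeff q = 0 → Polynomial.X ∣ φ q := by
    intro q hq
    rw [Polynomial.X_dvd_iff, Polynomial.coeff_zero_eq_eval_zero]
    exact (eval_zero_aeval_line q P).trans hq
  have hdvd : Polynomial.X ^ (s.erase u).card ∣ φ (B.submatrix id e).det := by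
    rw [AlgHom.map_det]
    refine pow_card_dvd_det _ _ _ fun r hr o => hX _ ?_
    rw [Finset.mem_erase] at hr
    rcases h : e o with _ | i
    · simp [B, h, Pi.single_apply, hr.1]
    · simpa [B, h] using hconst _ (constantCoeff_mem_AR hF (b i).2) r hr.2
  have hle : n + 1 ≤ (s.erase u).card := by
    have := Finset.pred_card_le_card_erase (s := s) (a := u)
    omega
  have h := ((pow_dvd_pow _ hle).trans hdvd).trans (map_dvd φ hBu)
  rw [show φ (pderiv u F) = _ from aeval_line hF.pderiv P, Nat.add_sub_cancel,
    Polynomial.X_pow_dvd_iff] at h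
  exact hP (by simpa using h n (by omega))

theorem Δ_eq (a b c : Fin 5) : Δ a b c =
    (X (1, b) * X (2, c) - X (1, c) * X (2, b)) * X (0, a)
      + (X (0, c) * (X (1, a) * X (2, b) - X (1, b) * X (2, a))
        - X (0, b) * (X (1, a) * X (2, c) - X (1, c) * X (2, a))) := by
  simp [Δ, Matrix.det_fin_three]
  ring

theorem Δ_rotate (a b c : Fin 5) : Δ a b c = Δ b c a := by
  rw [Δ_eq, Δ_eq]
  ring

theorem isHomogeneous_Δ (a b c : Fin 5) : (Δ a b c).IsHomogeneous 3 := by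
  have h : ∀ p q r : Fin 3 × Fin 5, (X p * X q * X r : S).IsHomogeneous 3 := fun p q r =>
    ((isHomogeneous_X ℂ p).mul (isHomogeneous_X ℂ q)).mul (isHomogeneous_X ℂ r)
  rw [Δ, Matrix.det_fin_three]
  exact (((((h _ _ _).sub (h _ _ _)).sub (h _ _ _)).add (h _ _ _)).add (h _ _ _)).sub (h _ _ _)

theorem prime_Δ {a b c : Fin 5} (hab : a ≠ b) (hac : a ≠ c) (hbc : b ≠ c) : Prime (Δ a b c) := by
  have hvars : ∀ (p : S) (v : Fin 3 × Fin 5), p ∈ supported ℂ {v}ᶜ → v ∉ p.vars := by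
    intro p v h hv
    exact mem_supported.1 h hv rfl
  have hX : ∀ {v w : Fin 3 × Fin 5}, w ≠ v → (X w : S) ∈ supported ℂ {v}ᶜ := fun h =>
    X_mem_supported.2 h
  have hminor : Irreducible (X (1, b) * X (2, c) - X (1, c) * X (2, b) : S) := by
    have := irreducible_mul_X_add (X (2, c) : S) (-(X (1, c) * X (2, b))) (1, b) (X_ne_zero _)
      (hvars _ _ (hX (by simp)))
      (hvars _ _ (neg_mem (mul_mem (hX (by simp [hbc.symm])) (hX (by simp)))))
      (X_prime.irreducible.isRelPrime_iff_not_dvd.2 ?_)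
    · convert this using 1
      ring
    · rintro ⟨q, hq⟩
      simpa [hbc] using congrArg (eval fun v => if v = (2, c) then (0 : ℂ) else 1) hq
  rw [← irreducible_iff_prime, Δ_eq]
  refine irreducible_mul_X_add _ _ _ hminor.ne_zero (hvars _ _ ?_) (hvars _ _ ?_)
    (hminor.isRelPrime_iff_not_dvd.2 ?_)
  · exact sub_mem (mul_mem (hX (by simp)) (hX (by simp))) (mul_mem (hX (by simp)) (hX (by simp)))
  · refine sub_mem (mul_mem (hX (by simp [hac.symm])) (sub_mem ?_ ?_))
      (mul_mem (hX (by simp [hab.symm])) (sub_mem ?_ ?_)) <;>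
    exact mul_mem (hX (by simp)) (hX (by simp))
  · rintro ⟨q, hq⟩
    simpa [hab, hac, hbc, hab.symm, hac.symm, hbc.symm] using
      congrArg (eval fun v => if v = (2, c) ∨ v = (1, a) ∨ v = (0, b) then (1 : ℂ) else 0) hq

/-- Each variable of a minor is isolated by its gradient at some zero of the minor. -/
theorem exists_eval_pderiv_Δ {a b c : Fin 5} (hab : a ≠ b) (hac : a ≠ c) (hbc : b ≠ c)
    {v : Fin 3 × Fin 5} (hv : v.2 = a ∨ v.2 = b ∨ v.2 = c) :
    ∃ P, eval P (Δ a b c) = 0 ∧ ∀ w, eval P (pderiv w (Δ a b c)) = if w = v then 1 else 0 := by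
  have first : ∀ {a b c : Fin 5}, a ≠ b → a ≠ c → b ≠ c → ∀ r : Fin 3, ∃ P,
      eval P (Δ a b c) = 0 ∧ ∀ w, eval P (pderiv w (Δ a b c)) = if w = (r, a) then 1 else 0 := by
    intro a b c hab hac hbc r
    refine ⟨fun v => if v = (r + 1, b) ∨ v = (r + 2, c) then 1 else 0, ?_, fun w => ?_⟩
    · fin_cases r <;> simp [Δ_eq, hab, hac, hbc, hbc.symm]
    · fin_cases r <;>
      simp [Δ_eq, hab, hac, hbc, hbc.symm, pderiv_X, Pi.single_apply, Prod.ext_iff,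
        apply_ite (eval _)] <;> grind
  obtain ⟨r, s⟩ := v
  rcases hv with rfl | rfl | rfl
  · exact first hab hac hbc r
  · rw [Δ_rotate]
    exact first hbc hab.symm hac.symm r
  · rw [Δ_rotate, Δ_rotate]
    exact first hac.symm hbc.symm hab r

/-- The columns of the minor `f i`. -/
def col : Fin 10 → Fin 5 × Fin 5 × Fin 5 :=
  ![(0, 1, 2), (0, 1, 3), (0, 2, 3), (1, 2, 3), (0, 1, 4),
    (0, 2, 4), (1, 2, 4), (0, 3, 4), (1, 3, 4), (2, 3, 4)]

theorem f_eq (i : Fin 10) : f i = Δ (col i).1 (col i).2.1 (col i).2.2 := by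
  fin_cases i <;> rfl

theorem col_lt (i : Fin 10) : (col i).1 < (col i).2.1 ∧ (col i).2.1 < (col i).2.2 := by
  revert i
  decide

theorem col_injective : Function.Injective col := by
  decide

/-- The variables occurring in the minor `f i`. -/
def entries (i : Fin 10) : Finset (Fin 3 × Fin 5) :=
  Finset.univ ×ˢ {(col i).1, (col i).2.1, (col i).2.2}

theorem card_entries_union {i j : Fin 10} (h : i ≠ j) : 12 ≤ (entries i ∪ entries j).card := by
  revert i j
  decide

theorem isHomogeneous_f (i : Fin 10) : (f i).IsHomogeneous 3 := f_eq i ▸ isHomogeneous_Δ _ _ _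

theorem prime_f (i : Fin 10) : Prime (f i) := by
  obtain ⟨h1, h2⟩ := col_lt i
  exact f_eq i ▸ prime_Δ h1.ne (h1.trans h2).ne h2.ne

theorem exists_eval_pderiv_f {i : Fin 10} {v : Fin 3 × Fin 5} (hv : v ∈ entries i) :
    ∃ P, eval P (f i) = 0 ∧ ∀ w, eval P (pderiv w (f i)) = if w = v then 1 else 0 := by
  obtain ⟨h1, h2⟩ := col_lt i
  exact f_eq i ▸ exists_eval_pderiv_Δ h1.ne (h1.trans h2).ne h2.ne (by simpa [entries] using hv)

theorem not_f_dvd_f {i j : Fin 10} (h : i ≠ j) : ¬ f i ∣ f j := by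
  rintro ⟨q, hq⟩
  have := congrArg (eval fun v : Fin 3 × Fin 5 =>
    if v = (0, (col j).1) ∨ v = (1, (col j).2.1) ∨ v = (2, (col j).2.2) then (1 : ℂ) else 0) hq
  obtain ⟨hi1, hi2⟩ := col_lt i
  obtain ⟨hj1, hj2⟩ := col_lt j
  have hij : col i ≠ col j := fun hc => h (col_injective hc)
  rw [map_mul, f_eq, f_eq, Δ_eq, Δ_eq] at this
  generalize col i = x at *
  generalize col j = y at *
  obtain ⟨a, b, c⟩ := x
  obtain ⟨a', b', c'⟩ := y
  simp only [ne_eq, Prod.mk.injEq] at hi1 hi2 hj1 hj2 hij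
  simp [hj1.ne, hj2.ne, hj1.ne', hj2.ne', (hj1.trans hj2).ne, (hj1.trans hj2).ne', mul_sub,
    ← ite_and] at this
  by_cases ha : a = a'
  · rw [if_pos ha] at this
    iterate 6 rw [if_neg (by omega)] at this
    simp at this
  · rw [if_neg ha] at this
    iterate 4 rw [if_neg (by omega)] at this
    simp at this

theorem f_dvd_of_dvd_mul {i j k : Fin 10} (hij : i ≠ j) (hik : i ≠ k) {q : S}
    (h : f i ∣ q * (f j * f k)) : f i ∣ q :=
  ((prime_f i).dvd_or_dvd h).resolve_right fun h' =>
    ((prime_f i).dvd_or_dvd h').elim (not_f_dvd_f hij) (not_f_dvd_f hik)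

/-- If the minor `f i` divides the derivative of `f i * f j * f k` in a constant direction, then
this direction does not involve the variables of `f i`. -/
theorem eq_zero_of_f_dvd {i j k : Fin 10} (hij : i ≠ j) (hik : i ≠ k) {c : Fin 3 × Fin 5 → ℂ}
    (h : f i ∣ ∑ v, C (c v) * pderiv v (f i * (f j * f k))) {v : Fin 3 × Fin 5}
    (hv : v ∈ entries i) : c v = 0 := by
  have hsum : ∑ v, C (c v) * pderiv v (f i * (f j * f k))
      = f i * (∑ v, C (c v) * pderiv v (f j * f k))
        + (∑ v, C (c v) * pderiv v (f i)) * (f j * f k) := by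
    simp only [Derivation.leibniz (pderiv _) (f i), smul_eq_mul, Finset.mul_sum, Finset.sum_mul,
      ← Finset.sum_add_distrib]
    exact Finset.sum_congr rfl fun v _ => by ring
  rw [hsum, dvd_add_right (dvd_mul_right _ _)] at h
  obtain ⟨q, hq⟩ := f_dvd_of_dvd_mul hij hik h
  obtain ⟨P, hP, hP'⟩ := exists_eval_pderiv_f hv
  simpa [hP, hP'] using congrArg (eval P) hq

theorem not_f_dvd_all_pderiv {i j k : Fin 10} (hij : i ≠ j) (hik : i ≠ k) :
    ∃ w, ¬ f i ∣ pderiv w (f i * (f j * f k)) := by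
  obtain ⟨v, hv⟩ : (entries i).Nonempty := ⟨(0, (col i).1), by simp [entries]⟩
  refine ⟨v, fun h => one_ne_zero (α := ℂ) ?_⟩
  refine (Pi.single_eq_same (M := fun _ => ℂ) v 1).symm.trans
    (eq_zero_of_f_dvd hij hik (Finset.dvd_sum fun w _ => ?_) hv)
  obtain rfl | hw := eq_or_ne w v
  · exact h.mul_left _
  · simp [hw]

/-- For pairwise distinct `i, j, k ∈ {1, …, 10}`, the arrangement defined by
`F_{ijk} = f_i f_j f_k` is never free. -/
theorem not_free_triples (i j k : Fin 10) (hij : i ≠ j) (hik : i ≠ k) (hjk : j ≠ k) :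
    ¬ Module.Free S (AR (f i * f j * f k)) := by
  have hi : f i * f j * f k = f i * (f j * f k) := mul_assoc _ _ _
  have hj : f i * f j * f k = f j * (f i * f k) := by ring
  have hk : f i * f j * f k = f k * (f i * f j) := by ring
  have hF : (f i * f j * f k).IsHomogeneous (8 + 1) :=
    ((isHomogeneous_f i).mul (isHomogeneous_f j)).mul (isHomogeneous_f k)
  refine not_free_AR hF (entries i ∪ entries j) (by have := card_entries_union hij; omega)
    (fun c hc v hv => ?_) (fun p hp => ?_)
  · obtain hv | hv := Finset.mem_union.1 hv
    · exact eq_zero_of_f_dvd hij hik (by rw [← hi, hc]; exact dvd_zero _) hv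
    · exact eq_zero_of_f_dvd hij.symm hjk (by rw [← hj, hc]; exact dvd_zero _) hv
  · by_contra! h
    have hpF : p ∣ f i * f j * f k := by
      have h9 : p ∣ 9 • (f i * f j * f k) := by
        rw [← hF.sum_X_mul_pderiv]
        exact Finset.dvd_sum fun w _ => (h w).mul_left _
      rw [nsmul_eq_mul] at h9
      refine (hp.dvd_or_dvd h9).resolve_left fun h' => hp.not_isUnit (isUnit_of_dvd_unit h' ?_)
      rw [← map_natCast C]
      exact (isUnit_iff_ne_zero.2 (by norm_num)).map C
    have key : ∀ l, p ∣ f l → ∀ w, f l ∣ pderiv w (f i * f j * f k) := fun l hl w =>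
      ((hp.associated_of_dvd (prime_f l) hl).symm.dvd).trans (h w)
    rcases hp.dvd_or_dvd hpF with hp' | hp'
    · rcases hp.dvd_or_dvd hp' with hp' | hp'
      · obtain ⟨w, hw⟩ := not_f_dvd_all_pderiv hij hik
        exact hw (hi ▸ key i hp' w)
      · obtain ⟨w, hw⟩ := not_f_dvd_all_pderiv hij.symm hjk
        exact hw (hj ▸ key j hp' w)
    · obtain ⟨w, hw⟩ := not_f_dvd_all_pderiv hik.symm hjk.symm
      exact hw (hk ▸ key k hp' w)
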